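/- Let α : ℤ × ℝ → ℂ be a solution of the Ablowitz–Ladik system (each t ↦ α_n(t) differentiable and satisfying the equation for all n and t). Define Q_n(t) = Q(α_n(t)) and let A_n(t) be the antisymmetric 3×3 matrix [[0, −2Re(conj(α_n)α_{n−1}), −2Im(α_n−α_{n−1})], [2Re(conj(α_n)α_{n−1}), 0, −2Re(α_n−α_{n−1})], [2Im(α_n−α_{n−1}), 2Re(α_n−α_{n−1}), 0]]. Then: (i) for all n ∈ ℤ and t ∈ ℝ, (d/dt)Q_n(t) = Q_n(t)A_{n+1}(t) − A_n(t)Q_n(t); (ii) if moreover P₀ : ℝ → M₃(ℝ) is differentiable with (d/dt)P₀ = P₀A₀, and P_n is defined for all n ∈ ℤ by the recursion P_{n+1}(t) = P_n(t)Q_n(t), then (d/dt)P_n(t) = P_n(t)A_n(t) for every n ∈ ℤ and t ∈ ℝ. -/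

import Mathlib

open Matrix
noncomputable section

/-- 3×3 real matrices. -/
abbrev Mat3 := Matrix (Fin 3) (Fin 3) ℝ

/-- Membership in SO(3): orthogonal with determinant 1. -/
def IsSO3 (M : Mat3) : Prop := M * Mᵀ = 1 ∧ M.det = 1

/-- The vector e₃ = (0,0,1). -/
def e3 : Fin 3 → ℝ := ![0, 0, 1]

/-- The matrix Q(z) = (1/(1+|z|²)) [[1−Re z², Im z², 2Re z], [Im z², 1+Re z², −2Im z],
[−2Re z, 2Im z, 1−|z|²]]. -/
def Qmat (z : ℂ) : Mat3 :=
  (1/(1 + Complex.normSq z)) •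
    !![1 - (z^2).re, (z^2).im, 2*z.re;
       (z^2).im, 1 + (z^2).re, -(2*z.im);
       -(2*z.re), 2*z.im, 1 - Complex.normSq z]

/-- `α : ℤ × ℝ → ℂ` is a (global) solution of the focusing Ablowitz–Ladik system:
each t ↦ α_n(t) is differentiable and i·(d/dt)α_n = −(1+|α_n|²)(α_{n+1}+α_{n−1}) + 2α_n. -/
def ALSolution (α : ℤ → ℝ → ℂ) : Prop :=
  ∀ (n : ℤ) (t : ℝ), ∃ d : ℂ,
    HasDerivAt (α n) d t ∧
    Complex.I * d
      = -(1 + (Complex.normSq (α n t) : ℂ)) * (α (n+1) t + α (n-1) t) + 2 * α n t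

/-- The antisymmetric matrix A_n built from a = α_n and b = α_{n−1}:
[[0, −2Re(conj(a)b), −2Im(a−b)], [2Re(conj(a)b), 0, −2Re(a−b)], [2Im(a−b), 2Re(a−b), 0]]. -/
def Amat (a b : ℂ) : Mat3 :=
  !![0, -(2 * ((starRingEnd ℂ) a * b).re), -(2 * (a - b).im);
     2 * ((starRingEnd ℂ) a * b).re, 0, -(2 * (a - b).re);
     2 * (a - b).im, 2 * (a - b).re, 0]

theorem Qmat_orth (z : ℂ) : Qmat z * (Qmat z)ᵀ = 1 := by
  have h : 1 + (z.re * z.re + z.im * z.im) ≠ 0 := by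
    exact ne_of_gt (by nlinarith [mul_self_nonneg z.re, mul_self_nonneg z.im])
  ext i j
  fin_cases i <;> fin_cases j <;>
  · simp [Qmat, Matrix.mul_apply, Fin.sum_univ_three, Complex.normSq_apply, pow_two]
    try field_simp
    try ring

theorem Amat_tr (a b : ℂ) : (Amat a b)ᵀ = - Amat a b := by
  ext i j
  fin_cases i <;> fin_cases j <;> simp [Amat]

set_option linter.unusedSimpArgs false in
theorem Qmat_deriv (f : ℝ → ℂ) (d p m : ℂ) (t : ℝ) (hf : HasDerivAt f d t)
    (hd : Complex.I * d = -(1 + (Complex.normSq (f t) : ℂ)) * (p + m) + 2 * f t)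
    (i j : Fin 3) :
    HasDerivAt (fun s : ℝ => Qmat (f s) i j)
      ((Qmat (f t) * Amat p (f t) - Amat (f t) m * Qmat (f t)) i j) t := by
  have hx : HasDerivAt (fun s => (f s).re) d.re t :=
    (Complex.reCLM.hasFDerivAt.comp_hasDerivAt t hf)
  have hy : HasDerivAt (fun s => (f s).im) d.im t :=
    (Complex.imCLM.hasFDerivAt.comp_hasDerivAt t hf)
  have h : 1 + ((f t).re * (f t).re + (f t).im * (f t).im) ≠ 0 :=
    ne_of_gt (by nlinarith [mul_self_nonneg (f t).re, mul_self_nonneg (f t).im])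
  have h1 := congrArg Complex.re hd
  have h2 := congrArg Complex.im hd
  simp [Complex.normSq_apply] at h1 h2
  have h1 : d.im = (1 + ((f t).re * (f t).re + (f t).im * (f t).im)) * (p.re + m.re)
    - 2 * (f t).re := by linarith
  rw [h1] at hy
  rw [h2] at hx
  have hN := ((hx.mul hx).add (hy.mul hy)).const_add 1
  have hI := (hasDerivAt_const t (1:ℝ)).div hN h
  have hA := (hx.mul hx).sub (hy.mul hy)
  have hB := (hx.mul hy).add (hy.mul hx)
  have hC := (hx.mul hx).add (hy.mul hy)
  fin_cases i <;> fin_cases j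
  · refine ((hI.mul (hA.const_sub 1)).congr_deriv ?_).congr_of_eventuallyEq (.of_forall fun s => ?_)
    all_goals (simp [Qmat, Amat, Matrix.mul_apply, Fin.sum_univ_three, Complex.normSq_apply, pow_two] <;> try (field_simp <;> try ring))
  · refine ((hI.mul hB).congr_deriv ?_).congr_of_eventuallyEq (.of_forall fun s => ?_)
    all_goals (simp [Qmat, Amat, Matrix.mul_apply, Fin.sum_univ_three, Complex.normSq_apply, pow_two] <;> try (field_simp <;> try ring))
  · refine ((hI.mul (hx.const_mul 2)).congr_deriv ?_).congr_of_eventuallyEq (.of_forall fun s => ?_)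
    all_goals (simp [Qmat, Amat, Matrix.mul_apply, Fin.sum_univ_three, Complex.normSq_apply, pow_two] <;> try (field_simp <;> try ring))
  · refine ((hI.mul hB).congr_deriv ?_).congr_of_eventuallyEq (.of_forall fun s => ?_)
    all_goals (simp [Qmat, Amat, Matrix.mul_apply, Fin.sum_univ_three, Complex.normSq_apply, pow_two] <;> try (field_simp <;> try ring))
  · refine ((hI.mul (hA.const_add 1)).congr_deriv ?_).congr_of_eventuallyEq (.of_forall fun s => ?_)
    all_goals (simp [Qmat, Amat, Matrix.mul_apply, Fin.sum_univ_three, Complex.normSq_apply, pow_two] <;> try (field_simp <;> try ring))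
  · refine ((hI.mul (hy.const_mul 2).neg).congr_deriv ?_).congr_of_eventuallyEq (.of_forall fun s => ?_)
    all_goals (simp [Qmat, Amat, Matrix.mul_apply, Fin.sum_univ_three, Complex.normSq_apply, pow_two] <;> try (field_simp <;> try ring))
  · refine ((hI.mul (hx.const_mul 2).neg).congr_deriv ?_).congr_of_eventuallyEq (.of_forall fun s => ?_)
    all_goals (simp [Qmat, Amat, Matrix.mul_apply, Fin.sum_univ_three, Complex.normSq_apply, pow_two] <;> try (field_simp <;> try ring))
  · refine ((hI.mul (hy.const_mul 2)).congr_deriv ?_).congr_of_eventuallyEq (.of_forall fun s => ?_)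
    all_goals (simp [Qmat, Amat, Matrix.mul_apply, Fin.sum_univ_three, Complex.normSq_apply, pow_two] <;> try (field_simp <;> try ring))
  · refine ((hI.mul (hC.const_sub 1)).congr_deriv ?_).congr_of_eventuallyEq (.of_forall fun s => ?_)
    all_goals (simp [Qmat, Amat, Matrix.mul_apply, Fin.sum_univ_three, Complex.normSq_apply, pow_two] <;> try (field_simp <;> try ring))

theorem mat_mul_deriv (F G : ℝ → Mat3) (F' G' : Mat3) (t : ℝ)
    (hF : ∀ i j, HasDerivAt (fun s => F s i j) (F' i j) t)
    (hG : ∀ i j, HasDerivAt (fun s => G s i j) (G' i j) t) (i j : Fin 3) :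
    HasDerivAt (fun s => (F s * G s) i j) ((F' * G t + F t * G') i j) t := by
  have := HasDerivAt.fun_sum (u := Finset.univ) fun k _ => (hF i k).mul (hG k j)
  simpa [Matrix.mul_apply, Matrix.add_apply, Finset.sum_add_distrib] using this

/-- (i) the zero-curvature equation (d/dt)Q_n = Q_n A_{n+1} − A_n Q_n;
(ii) if (d/dt)P₀ = P₀A₀ and P_{n+1} = P_n Q_n, then (d/dt)P_n = P_n A_n for all n.
(Derivatives of matrix-valued functions are expressed entrywise.) -/
theorem zero_curvature_and_frame_evolution (α : ℤ → ℝ → ℂ) (hα : ALSolution α) :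
    (∀ (n : ℤ) (t : ℝ) (i j : Fin 3),
      HasDerivAt (fun s : ℝ => Qmat (α n s) i j)
        ((Qmat (α n t) * Amat (α (n+1) t) (α n t)
          - Amat (α n t) (α (n-1) t) * Qmat (α n t)) i j) t) ∧
    (∀ P : ℤ → ℝ → Mat3,
      (∀ (t : ℝ) (i j : Fin 3),
        HasDerivAt (fun s : ℝ => P 0 s i j) ((P 0 t * Amat (α 0 t) (α (-1) t)) i j) t) →
      (∀ (n : ℤ) (t : ℝ), P (n+1) t = P n t * Qmat (α n t)) →
      ∀ (n : ℤ) (t : ℝ) (i j : Fin 3),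
        HasDerivAt (fun s : ℝ => P n s i j) ((P n t * Amat (α n t) (α (n-1) t)) i j) t) := by
  have hQ : ∀ (n : ℤ) (t : ℝ) (i j : Fin 3),
      HasDerivAt (fun s : ℝ => Qmat (α n s) i j)
        ((Qmat (α n t) * Amat (α (n+1) t) (α n t)
          - Amat (α n t) (α (n-1) t) * Qmat (α n t)) i j) t := by
    intro n t i j
    obtain ⟨d, hd, he⟩ := hα n t
    exact Qmat_deriv (α n) d _ _ t hd he i j
  refine ⟨hQ, ?_⟩
  intro P h0 hrec n
  induction n using Int.induction_on with
  | zero => simpa using h0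
  | succ n ih =>
    intro t i j
    have h := mat_mul_deriv _ _ _ _ t (ih t) (hQ n t) i j
    simp only [← hrec] at h
    refine h.congr_deriv ?_
    refine congrFun (congrFun ?_ i) j
    rw [hrec, add_sub_cancel_right, Matrix.mul_sub]
    simp only [Matrix.mul_assoc]
    abel
  | pred n ih =>
    intro t i j
    have e : ∀ s, P (-(n:ℤ) - 1) s = P (-n) s * (Qmat (α (-n - 1) s))ᵀ := by
      intro s
      have := hrec (-n - 1) s
      rw [sub_add_cancel] at this
      rw [this, Matrix.mul_assoc, Qmat_orth, Matrix.mul_one]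
    have h := mat_mul_deriv _ (fun s => (Qmat (α (-n - 1) s))ᵀ) _ t (ih t)
      (G' := (Qmat (α (-n-1) t) * Amat (α (-n-1+1) t) (α (-n-1) t)
          - Amat (α (-n-1) t) (α (-n-1-1) t) * Qmat (α (-n-1) t))ᵀ)
      (fun i j => hQ (-n-1) t j i) i j
    simp only [← e] at h
    refine h.congr_deriv ?_
    refine congrFun (congrFun ?_ i) j
    rw [e, Matrix.transpose_sub, Matrix.transpose_mul, Matrix.transpose_mul, Amat_tr, Amat_tr,
      sub_add_cancel, Matrix.mul_sub]
    simp only [Matrix.mul_assoc, Matrix.neg_mul, Matrix.mul_neg]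
    abel
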